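/- Let φ and φ' be constraints with total orders <_T, <_P on the tasks and phasers of φ and <_{T'}, <_{P'} on those of φ'. If the encodings satisfy ⌈φ⌉ ⊑_e ⌈φ'⌉, then φ ⊑ φ' (φ is entailed by φ'). -/

import Mathlib

universe u v w

/-- A gap quadruple `(lw, ls, uw, us)` with `lw, ls ∈ ℕ` and `uw, us ∈ ℕ ∪ {∞}`. -/
structure GapVal where
  lw : ℕ
  ls : ℕ
  uw : ℕ∞
  us : ℕ∞

/-- Well-formedness of a gap quadruple: either both upper bounds are finite,
or both are `∞`. -/
def GapVal.WF (g : GapVal) : Prop :=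
  (g.uw ≠ ⊤ ∧ g.us ≠ ⊤) ∨ (g.uw = ⊤ ∧ g.us = ⊤)

/-- A named gap over `Var`: a variable together with either `nreg`
(modelled by `none`) or a gap quadruple. -/
abbrev NamedGap (Var : Type u) := Var × Option GapVal

/-- A gap quadruple is free if both its upper bounds are `∞`. -/
def GapVal.Free (g : GapVal) : Prop := g.uw = ⊤ ∧ g.us = ⊤

/-- A gap quadruple is `B`-gap-bounded if both its upper bounds are at most `B`. -/
def GapVal.Bounded (B : ℕ) (g : GapVal) : Prop := g.uw ≤ (B : ℕ∞) ∧ g.us ≤ (B : ℕ∞)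

/-- The order `⊴` on named gaps, where `star` is the wildcard element of `Var`. -/
def gapLe {Var : Type u} (star : Var) (a b : NamedGap Var) : Prop :=
  (a.1 ≠ b.1 → a.1 = star) ∧
  (a.2 = none ↔ b.2 = none) ∧
  ∀ v v' : GapVal, a.2 = some v → b.2 = some v' →
    v.lw ≤ v'.lw ∧ v.ls ≤ v'.ls ∧ v'.uw ≤ v.uw ∧ v'.us ≤ v.us

/-- A set of named gaps is `B`-good if each of its elements carrying a gap
quadruple is free or `B`-gap-bounded. -/
def GoodSet {Var : Type u} (B : ℕ) (G : Set (NamedGap Var)) : Prop :=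
  ∀ g ∈ G, ∀ v : GapVal, g.2 = some v → v.Free ∨ v.Bounded B

/-- `r` is a well-quasi-order on the subset `S`: every infinite sequence of
elements of `S` contains indices `i < j` with `r (f i) (f j)`. -/
def IsWQOOn {α : Type u} (S : Set α) (r : α → α → Prop) : Prop :=
  ∀ f : ℕ → α, (∀ n, f n ∈ S) → ∃ i j, i < j ∧ r (f i) (f j)

/-- A task state of dimension `K`. -/
abbrev TaskState (UnrSuff : Type u) (Var : Type v) (K : ℕ) :=
  UnrSuff × (Fin K → NamedGap Var)

/-- The order `≼` on task states, where `starU` and `star` are the wildcard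
elements of `UnrSuff` and `Var` respectively. -/
def taskLe {UnrSuff : Type u} {Var : Type v} (starU : UnrSuff) (star : Var) {K : ℕ}
    (a b : TaskState UnrSuff Var K) : Prop :=
  (a.1 ≠ b.1 → a.1 = starU) ∧ ∀ k, gapLe star (a.2 k) (b.2 k)

/-- `A ∀∃≼ B`: every element of `A` is `r`-below some element of `B`. -/
def forallExists {α : Type u} (r : α → α → Prop) (A B : Multiset α) : Prop :=
  ∀ a ∈ A, ∃ b ∈ B, r a b

/-- `A ∃∀≼ B`: every element of `B` is `r`-above some element of `A`. -/
def existsForall {α : Type u} (r : α → α → Prop) (A B : Multiset α) : Prop :=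
  ∀ b ∈ B, ∃ a ∈ A, r a b

/-- A configuration: finite sets of tasks and phasers (modelled as finite sets
of naturals), a Boolean valuation, control sequences, and phases.  In a phase
`(var, some (w, s))`, `w` is the wait value and `s` the signal value, while
`(var, none)` means the task is not registered to the phaser. -/
structure Config (BV : Type u) (Var : Type v) (UnrSuff : Type w) where
  T : Finset ℕ
  P : Finset ℕ
  bv : BV → Bool
  seq : ℕ → UnrSuff
  phase : ℕ → ℕ → Var × Option (ℕ × ℕ)

/-- A constraint: finite sets of tasks and phasers, a Boolean valuation with
wildcard (`none` is `*`), control sequences, named gaps, and environment gaps. -/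
structure Constraint (BV : Type u) (Var : Type v) (UnrSuff : Type w) where
  T : Finset ℕ
  P : Finset ℕ
  bv : BV → Option Bool
  seq : ℕ → UnrSuff
  gap : ℕ → ℕ → NamedGap Var
  egap : ℕ → ℕ × ℕ

/-- `c ⊨ φ`: the configuration `c` is denoted by the constraint `φ`.
The inequalities `lw ≤ l − w ≤ uw` and `ls ≤ s − l ≤ us` are rendered
additively (`w + lw ≤ l`, etc.) to avoid truncated subtraction issues. -/
def Denotes {BV : Type u} {Var : Type v} {UnrSuff : Type w} (star : Var) (starU : UnrSuff)
    (φ : Constraint BV Var UnrSuff) (c : Config BV Var UnrSuff) : Prop :=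
  (∀ b, φ.bv b ≠ some (c.bv b) → φ.bv b = none) ∧
  ∃ T1 ⊆ c.T, ∃ P1 ⊆ c.P, ∃ τ : ℕ → ℕ, ∃ π : ℕ → ℕ,
    T1.image τ = φ.T ∧ Set.InjOn π ↑P1 ∧ P1.image π = φ.P ∧
    (∀ t ∈ T1, φ.seq (τ t) ≠ c.seq t → φ.seq (τ t) = starU) ∧
    ∀ p ∈ P1, ∃ l : ℕ,
      (∀ t ∈ T1,
        ((c.phase t p).1 ≠ (φ.gap (τ t) (π p)).1 → (φ.gap (τ t) (π p)).1 = star) ∧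
        ((c.phase t p).2 = none ↔ (φ.gap (τ t) (π p)).2 = none) ∧
        (∀ w s : ℕ, ∀ v : GapVal, (c.phase t p).2 = some (w, s) →
          (φ.gap (τ t) (π p)).2 = some v →
          w + v.lw ≤ l ∧ ((l - w : ℕ) : ℕ∞) ≤ v.uw ∧
          l + v.ls ≤ s ∧ ((s - l : ℕ) : ℕ∞) ≤ v.us)) ∧
      (∀ t ∈ c.T, t ∉ T1 → ∀ w s : ℕ, (c.phase t p).2 = some (w, s) →
        w + (φ.egap (π p)).1 ≤ l ∧ l + (φ.egap (π p)).2 ≤ s)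

/-- The denotation `⟦φ⟧` of a constraint. -/
def Denotation {BV : Type u} {Var : Type v} {UnrSuff : Type w} (star : Var) (starU : UnrSuff)
    (φ : Constraint BV Var UnrSuff) : Set (Config BV Var UnrSuff) :=
  {c | Denotes star starU φ c}

/-- `φa ⊑ φb`: the constraint `φa` is entailed by the constraint `φb`. -/
def Entails {BV : Type u} {Var : Type v} {UnrSuff : Type w} (star : Var) (starU : UnrSuff)
    (φa φb : Constraint BV Var UnrSuff) : Prop :=
  (∀ b, φa.bv b ≠ φb.bv b → φa.bv b = none) ∧
  ∃ T1 ⊆ φb.T, ∃ P1 ⊆ φb.P, ∃ τ : ℕ → ℕ, ∃ π : ℕ → ℕ,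
    T1.image τ = φa.T ∧ Set.InjOn π ↑P1 ∧ P1.image π = φa.P ∧
    (∀ t ∈ T1, φa.seq (τ t) ≠ φb.seq t → φa.seq (τ t) = starU) ∧
    ∀ p ∈ P1,
      ((φa.egap (π p)).1 ≤ (φb.egap p).1 ∧ (φa.egap (π p)).2 ≤ (φb.egap p).2) ∧
      (∀ t ∈ T1, gapLe star (φa.gap (τ t) (π p)) (φb.gap t p)) ∧
      (∀ t ∈ φb.T, t ∉ T1 → ∀ v : GapVal, (φb.gap t p).2 = some v →
        (φa.egap (π p)).1 ≤ v.lw ∧ (φa.egap (π p)).2 ≤ v.ls)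

/-- A constraint is `B`-good if all the named gaps of its tasks/phasers
carrying a quadruple are free or `B`-gap-bounded. -/
def ConstraintBGood {BV : Type u} {Var : Type v} {UnrSuff : Type w} (B : ℕ)
    (φ : Constraint BV Var UnrSuff) : Prop :=
  ∀ t ∈ φ.T, ∀ p ∈ φ.P, ∀ v : GapVal, (φ.gap t p).2 = some v → v.Free ∨ v.Bounded B

/-- An encoding of a constraint: `L` task indices, `M` phaser indices. -/
structure Encoding (BV : Type u) (Var : Type v) (UnrSuff : Type w) where
  L : ℕ
  M : ℕ
  bv : BV → Option Bool
  acc : Fin L → UnrSuff × (Fin M → NamedGap Var)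
  env : Fin M → ℕ × ℕ

/-- `e` enumerates the finite set `S` (this corresponds to choosing a total
order on `S`, the element of index `i` being `e i`). -/
def IsEnum (S : Finset ℕ) (e : Fin S.card → ℕ) : Prop :=
  Function.Injective e ∧ ∀ i, e i ∈ S

/-- The encoding `⌈φ⌉` of a constraint `φ` with respect to enumerations
(total orders) `eT` of its tasks and `eP` of its phasers. -/
def encodingOf {BV : Type u} {Var : Type v} {UnrSuff : Type w}
    (φ : Constraint BV Var UnrSuff)
    (eT : Fin φ.T.card → ℕ) (eP : Fin φ.P.card → ℕ) : Encoding BV Var UnrSuff where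
  L := φ.T.card
  M := φ.P.card
  bv := φ.bv
  acc := fun i => (φ.seq (eT i), fun j => φ.gap (eT i) (eP j))
  env := fun j => φ.egap (eP j)

/-- The entailment relation `⊑ₑ` on encodings. -/
def EncEntails {BV : Type u} {Var : Type v} {UnrSuff : Type w} (star : Var) (starU : UnrSuff)
    (e e' : Encoding BV Var UnrSuff) : Prop :=
  (∀ b, e.bv b ≠ e'.bv b → e.bv b = none) ∧
  ∃ hM : e.M = e'.M, ∃ h : Fin e'.L → Fin e.L, Function.Surjective h ∧
    (∀ i : Fin e'.L,
      ((e.acc (h i)).1 ≠ (e'.acc i).1 → (e.acc (h i)).1 = starU) ∧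
      ∀ j : Fin e.M, gapLe star ((e.acc (h i)).2 j) ((e'.acc i).2 (Fin.cast hM j))) ∧
    (∀ j : Fin e.M, (e.env j).1 ≤ (e'.env (Fin.cast hM j)).1 ∧
      (e.env j).2 ≤ (e'.env (Fin.cast hM j)).2)

/-- An encoding is `B`-good if every named gap occurring in it and carrying a
quadruple is free or `B`-gap-bounded. -/
def EncodingBGood {BV : Type u} {Var : Type v} {UnrSuff : Type w} (B : ℕ)
    (e : Encoding BV Var UnrSuff) : Prop :=
  ∀ (i : Fin e.L) (j : Fin e.M) (v : GapVal),
    ((e.acc i).2 j).2 = some v → v.Free ∨ v.Bounded B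

theorem IsEnum.image_univ {S : Finset ℕ} {e : Fin S.card → ℕ} (he : IsEnum S e) :
    Finset.univ.image e = S :=
  Finset.eq_of_subset_of_card_le (Finset.image_subset_iff.2 fun i _ => he.2 i)
    (by rw [Finset.card_image_of_injective _ he.1, Finset.card_fin])

theorem IsEnum.forall_mem_iff {S : Finset ℕ} {e : Fin S.card → ℕ} (he : IsEnum S e)
    {p : ℕ → Prop} : (∀ n ∈ S, p n) ↔ ∀ i, p (e i) := by
  conv_lhs => rw [← he.image_univ]
  simp

/-- A function on indices transfers along enumerations to a function on the enumerated sets. -/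
theorem IsEnum.image_extend {S S' : Finset ℕ} {e : Fin S.card → ℕ} {e' : Fin S'.card → ℕ}
    (he : IsEnum S e) (he' : IsEnum S' e') {f : Fin S'.card → Fin S.card}
    (hf : Function.Surjective f) :
    S'.image (Function.extend e' (e ∘ f) id) = S := by
  rw [← congrArg (Finset.image _) he'.image_univ, Finset.image_image,
    Function.extend_comp he'.1, ← Finset.image_image,
    Finset.image_univ_of_surjective hf, he.image_univ]

/-- If the encodings of two constraints (w.r.t. total orders on
their tasks and phasers) satisfy `⌈φ⌉ ⊑ₑ ⌈φ'⌉`, then `φ ⊑ φ'`. -/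
theorem encEntails_implies_entails {BV : Type u} {Var : Type v} {UnrSuff : Type w}
    (star : Var) (starU : UnrSuff) (φ φ' : Constraint BV Var UnrSuff)
    (eT : Fin φ.T.card → ℕ) (eP : Fin φ.P.card → ℕ)
    (eT' : Fin φ'.T.card → ℕ) (eP' : Fin φ'.P.card → ℕ)
    (hT : IsEnum φ.T eT) (hP : IsEnum φ.P eP)
    (hT' : IsEnum φ'.T eT') (hP' : IsEnum φ'.P eP')
    (h : EncEntails star starU (encodingOf φ eT eP) (encodingOf φ' eT' eP')) :
    Entails star starU φ φ' := by
  obtain ⟨hbv, hM, f, hf, hacc, henv⟩ := h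
  replace hM : φ.P.card = φ'.P.card := hM
  have hτ (i) : Function.extend eT' (eT ∘ f) id (eT' i) = eT (f i) := hT'.1.extend_apply _ _ i
  have hπ (j) : Function.extend eP' (eP ∘ Fin.cast hM.symm) id (eP' j) =
      eP (Fin.cast hM.symm j) := hP'.1.extend_apply _ _ j
  have hπ_image : φ'.P.image (Function.extend eP' (eP ∘ Fin.cast hM.symm) id) = φ.P :=
    hP.image_extend hP' (finCongr hM.symm).surjective
  refine ⟨hbv, φ'.T, subset_rfl, φ'.P, subset_rfl, Function.extend eT' (eT ∘ f) id,
    Function.extend eP' (eP ∘ Fin.cast hM.symm) id, hT.image_extend hT' hf,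
    Finset.card_image_iff.1 (by rw [hπ_image, hM]), hπ_image,
    hT'.forall_mem_iff.2 fun i => ?_, hP'.forall_mem_iff.2 fun j =>
      ⟨?_, hT'.forall_mem_iff.2 fun i => ?_, fun t ht ht' => absurd ht ht'⟩⟩
  · rw [hτ]
    exact (hacc i).1
  · rw [hπ]
    exact henv (Fin.cast hM.symm j)
  · rw [hτ, hπ]
    exact (hacc i).2 (Fin.cast hM.symm j)
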